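/- Let p be a prime with p ≡ 1 (mod 4), n an even positive integer, and f : F_{p^n} → F_p a weakly regular bent function with W_f(b) = u p^{n/2} ω_p^{f*(b)} for all b (u ∈ {1,−1}), such that f(tx) = t^k f(x) for all t ∈ F_p, x ∈ F_{p^n} with gcd(k−1,p−1) = 1. Then in the complex group algebra ℂ[(F_{p^n},+)]: p²·D_0² = (−p^n + 2p|D_0| − u·p^{n/2}·(p−2))·[F_{p^n}] + u·p·(p−2)·p^{n/2}·D_0 + (p−1)·p^n·[0]. -/

import Mathlib

open Finset

noncomputable section
open scoped Classical

noncomputable instance (p n : ℕ) [Fact p.Prime] : Fintype (GaloisField p n) :=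
  Fintype.ofFinite _

/-- `ω_p^a` for `a ∈ F_p`, where `ω_p = exp(2πi/p)`. -/
def ez (p : ℕ) (a : ZMod p) : ℂ :=
  Complex.exp (2 * Real.pi * Complex.I * (a.val : ℂ) / p)

/-- The Walsh coefficient `W_f(b) = ∑_{x∈F_{p^n}} ω_p^{f(x)+Tr(bx)}`. -/
def walsh (p n : ℕ) [Fact p.Prime] (f : GaloisField p n → ZMod p) (b : GaloisField p n) : ℂ :=
  ∑ x : GaloisField p n,
    ez p (f x + Algebra.trace (ZMod p) (GaloisField p n) (b * x))

/-- The quadratic Gauss sum `G = ∑_{t∈F_p} ω_p^{t²}`. -/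
def gaussSum' (p : ℕ) [NeZero p] : ℂ := ∑ t : ZMod p, ez p (t ^ 2)

/-- The element `∑_{x∈S} x` of the group algebra `ℂ[(F_{p^n},+)]` attached to a subset `S`. -/
def elt (p n : ℕ) [Fact p.Prime] (S : Finset (GaloisField p n)) :
    AddMonoidAlgebra ℂ (GaloisField p n) :=
  ∑ x ∈ S, AddMonoidAlgebra.single x (1 : ℂ)

lemma ez_eq_stdAddChar (p : ℕ) [NeZero p] (a : ZMod p) : ez p a = ZMod.stdAddChar a := by
  rw [ZMod.stdAddChar_apply, ZMod.toCircle_apply, ez]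

/-- The only rational linear relation between the `p`-th roots of unity is that their sum is `0`. -/
lemma coeff_eq_of_sum_mul_stdAddChar_eq_zero {p : ℕ} [Fact p.Prime] {c : ZMod p → ℚ}
    (h : ∑ i, (c i : ℂ) * ZMod.stdAddChar i = 0) (i j : ZMod p) : c i = c j := by
  have hp : p.Prime := Fact.out
  set ζ : ℂ := Complex.exp (2 * Real.pi * Complex.I / p) with hζ_def
  have hζ : IsPrimitiveRoot ζ p := Complex.isPrimitiveRoot_exp p hp.ne_zero
  have hpow (a : ZMod p) : ZMod.stdAddChar a = ζ ^ a.val := by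
    rw [← ez_eq_stdAddChar, ez, hζ_def, ← Complex.exp_nat_mul]
    congr 1
    ring
  set P : Polynomial ℚ := ∑ a : ZMod p, Polynomial.monomial a.val (c a) with hP
  have hcoeff (a : ZMod p) : P.coeff a.val = c a := by
    simp only [hP, Polynomial.finsetSum_coeff, Polynomial.coeff_monomial]
    simp [(ZMod.val_injective p).eq_iff]
  have hroot : Polynomial.aeval ζ P = 0 := by
    rw [hP, map_sum, ← h]
    refine Finset.sum_congr rfl fun a _ => ?_
    rw [Polynomial.aeval_monomial, hpow]
    simp
  have hdvd : Polynomial.cyclotomic p ℚ ∣ P := by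
    rw [Polynomial.cyclotomic_eq_minpoly_rat hζ hp.pos]
    exact minpoly.dvd ℚ ζ hroot
  obtain ⟨Q, hQ⟩ := hdvd
  have hdeg : P.natDegree ≤ p - 1 := by
    refine Polynomial.natDegree_sum_le_of_forall_le _ _ fun a _ => ?_
    exact (Polynomial.natDegree_monomial_le _).trans (Nat.le_sub_one_of_lt a.val_lt)
  have hQdeg : Q.natDegree = 0 := by
    rcases eq_or_ne Q 0 with rfl | hQ0
    · simp
    · rw [hQ, Polynomial.natDegree_mul (Polynomial.cyclotomic_ne_zero p ℚ) hQ0,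
        Polynomial.natDegree_cyclotomic, Nat.totient_prime hp] at hdeg
      lia
  rw [Polynomial.eq_C_of_natDegree_eq_zero hQdeg] at hQ
  have hconst (a : ZMod p) : c a = Q.coeff 0 := by
    rw [← hcoeff, hQ, Polynomial.coeff_mul_C, Polynomial.cyclotomic_prime]
    simp [Polynomial.coeff_X_pow, a.val_lt]
  rw [hconst, hconst]

section Counting

variable {p : ℕ} [Fact p.Prime] {X : Type*} [Fintype X]

lemma sum_stdAddChar_mul_eq_sum_card (g : X → ZMod p) (s : ZMod p) :
    ∑ x, (ZMod.stdAddChar (s * g x) : ℂ) = ∑ i, (#{x | g x = i} : ℂ) * ZMod.stdAddChar (s * i) := by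
  rw [← Finset.sum_fiberwise univ g]
  refine Finset.sum_congr rfl fun i _ => ?_
  rw [Finset.sum_congr rfl fun x hx => by rw [(Finset.mem_filter.mp hx).2], Finset.sum_const,
    nsmul_eq_mul]

lemma card_fiber_sub_eq_of_sum_stdAddChar {g : X → ZMod p} {m : ℤ} {j : ZMod p}
    (h : ∑ x, (ZMod.stdAddChar (g x) : ℂ) = m * ZMod.stdAddChar j) (i i' : ZMod p) :
    (#{x | g x = i} : ℤ) - (if i = j then m else 0) =
      #{x | g x = i'} - (if i' = j then m else 0) := by
  have key := coeff_eq_of_sum_mul_stdAddChar_eq_zero (p := p)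
    (c := fun i => (#{x | g x = i} : ℚ) - (if i = j then (m : ℚ) else 0)) (by
      have h1 := sum_stdAddChar_mul_eq_sum_card g 1
      simp only [one_mul] at h1
      push_cast
      simp only [sub_mul, Finset.sum_sub_distrib, ← h1, h]
      simp [apply_ite (Rat.cast : ℚ → ℂ)]) i i'
  exact_mod_cast key

/-- Galois conjugation of an equation between a sum of `p`-th roots of unity and an integer
multiple of a `p`-th root of unity. -/
lemma sum_stdAddChar_mul_of_sum_stdAddChar {g : X → ZMod p} {m : ℤ} {j : ZMod p}
    (h : ∑ x, (ZMod.stdAddChar (g x) : ℂ) = m * ZMod.stdAddChar j) {s : ZMod p} (hs : s ≠ 0) :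
    ∑ x, (ZMod.stdAddChar (s * g x) : ℂ) = m * ZMod.stdAddChar (s * j) := by
  obtain ⟨c, hcard⟩ : ∃ c : ℂ, ∀ i, (#{x | g x = i} : ℂ) = c + if i = j then (m : ℂ) else 0 := by
    refine ⟨(#{x | g x = j} : ℂ) - m, fun i => ?_⟩
    have := card_fiber_sub_eq_of_sum_stdAddChar h i j
    rw [if_pos rfl, sub_eq_iff_eq_add] at this
    exact_mod_cast congrArg (Int.cast : ℤ → ℂ) this
  have hzero : ∑ i : ZMod p, (ZMod.stdAddChar (s * i) : ℂ) = 0 := by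
    have := AddChar.sum_mulShift s (ZMod.isPrimitive_stdAddChar p)
    simpa [mul_comm, hs] using this
  rw [sum_stdAddChar_mul_eq_sum_card]
  simp only [hcard, add_mul, Finset.sum_add_distrib, ← Finset.mul_sum, hzero]
  simp

end Counting

lemma sum_eq_zero_add_sum_units {K M : Type*} [Field K] [Fintype K] [Fintype Kˣ] [AddCommMonoid M]
    (g : K → M) : ∑ t, g t = g 0 + ∑ t : Kˣ, g t := by
  rw [Fintype.sum_eq_add_sum_compl (0 : K)]
  congr 1
  refine Finset.sum_bij' (fun t ht => Units.mk0 t (by simpa using ht)) (fun t _ => (t : K))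
    ?_ ?_ ?_ ?_ ?_ <;> intros <;> simp

/-- The algebra homomorphism `ℂ[K] → ℂ` extending the additive character `x ↦ ψ (b * x)`. -/
def charHom {K : Type*} [CommRing K] (ψ : AddChar K ℂ) (b : K) : AddMonoidAlgebra ℂ K →ₐ[ℂ] ℂ :=
  AddMonoidAlgebra.lift ℂ ℂ K (ψ.mulShift b).toMonoidHom

lemma charHom_single {K : Type*} [CommRing K] (ψ : AddChar K ℂ) (b x : K) (r : ℂ) :
    charHom ψ b (AddMonoidAlgebra.single x r) = r * ψ (b * x) := by
  simp [charHom]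

/-- An element of the group algebra of a finite field is determined by its character values. -/
lemma eq_of_charHom_eq {K : Type*} [Field K] [Fintype K] {ψ : AddChar K ℂ} (hψ : ψ.IsPrimitive)
    {F G : AddMonoidAlgebra ℂ K} (h : ∀ b, charHom ψ b F = charHom ψ b G) : F = G := by
  have inversion (F : AddMonoidAlgebra ℂ K) (y : K) :
      ∑ b, ψ (b * -y) * charHom ψ b F = Fintype.card K * F.coeff y := by
    induction F using AddMonoidAlgebra.induction_linear with
    | zero => simp
    | add F G hF hG => 
      rw [AddMonoidAlgebra.coeff_add, Finsupp.add_apply, mul_add, ← hF, ← hG,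
        ← Finset.sum_add_distrib]
      exact Finset.sum_congr rfl fun b _ => by rw [map_add, mul_add]
    | single x r =>
      have h1 (b : K) : ψ (b * -y) * charHom ψ b (AddMonoidAlgebra.single x r) =
          r * ψ (b * (x - y)) := by
        rw [charHom_single, mul_left_comm, ← AddChar.map_add_eq_mul]
        ring_nf
      simp only [h1, ← Finset.mul_sum, AddChar.sum_mulShift _ hψ, sub_eq_zero]
      by_cases hxy : x = y <;> simp [hxy, mul_comm]
  ext y
  have := (inversion F y).symm.trans (by simp only [h]; exact inversion G y)
  exact mul_left_cancel₀ (Nat.cast_ne_zero.mpr Fintype.card_ne_zero) this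

lemma even_card_of_neg_mem {K : Type*} [Field K] (h2 : (2 : K) ≠ 0) {S : Finset K}
    (h0 : 0 ∉ S) (hneg : ∀ x ∈ S, -x ∈ S) : Even #S := by
  rw [← ZMod.natCast_eq_zero_iff_even, Finset.cast_card]
  refine Finset.sum_involution (fun x _ => -x) (fun _ _ => by decide) (fun x hx _ hx' => ?_)
    (fun x hx => hneg x hx) (fun x _ => neg_neg x)
  have h : 2 * x = 0 := by linear_combination -hx'
  rcases mul_eq_zero.mp h with h | h
  · exact h2 h
  · exact h0 (h ▸ hx)

section Trace

variable (p n : ℕ) [Fact p.Prime]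

/-- The canonical additive character `x ↦ ω_p^{Tr(x)}` of `F_{p^n}`. -/
def traceChar : AddChar (GaloisField p n) ℂ :=
  ZMod.stdAddChar.compAddMonoidHom (Algebra.trace (ZMod p) (GaloisField p n)).toAddMonoidHom

lemma traceChar_apply (x : GaloisField p n) :
    traceChar p n x = ZMod.stdAddChar (Algebra.trace (ZMod p) (GaloisField p n) x) := rfl

lemma isPrimitive_traceChar : (traceChar p n).IsPrimitive := by
  refine AddChar.IsPrimitive.of_ne_one fun h => ?_
  obtain ⟨x, hx⟩ := Algebra.trace_surjective (ZMod p) (GaloisField p n) 1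
  have h1 : (ZMod.stdAddChar (1 : ZMod p) : ℂ) = ZMod.stdAddChar (0 : ZMod p) := by
    rw [← hx, ← traceChar_apply, h, AddChar.one_apply, AddChar.map_zero_eq_one]
  exact one_ne_zero (ZMod.injective_stdAddChar h1)

lemma card_galoisField {n : ℕ} (hn : n ≠ 0) : Fintype.card (GaloisField p n) = p ^ n := by
  rw [← Nat.card_eq_fintype_card, GaloisField.card p n hn]

lemma charHom_elt (b : GaloisField p n) (S : Finset (GaloisField p n)) :
    charHom (traceChar p n) b (elt p n S) = ∑ x ∈ S, traceChar p n (b * x) := by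
  simp [elt, charHom_single]

lemma charHom_elt_univ {n : ℕ} (hn : n ≠ 0) (b : GaloisField p n) :
    charHom (traceChar p n) b (elt p n univ) = if b = 0 then (p : ℂ) ^ n else 0 := by
  rw [charHom_elt]
  simp only [mul_comm b]
  rw [AddChar.sum_mulShift b (isPrimitive_traceChar p n), card_galoisField p hn]
  split_ifs <;> simp

end Trace

section Bent

variable {p n : ℕ} [Fact p.Prime] {f : GaloisField p n → ZMod p}

lemma walsh_eq_sum_stdAddChar (b : GaloisField p n) : walsh p n f b =
    ∑ x, (ZMod.stdAddChar (f x + Algebra.trace (ZMod p) (GaloisField p n) (b * x)) : ℂ) := by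
  simp only [walsh, ez_eq_stdAddChar]

lemma sum_stdAddChar_unit_pow_mul_add_trace {k : ℕ} (hk : 0 < k)
    (hhom : ∀ (t : ZMod p) (x : GaloisField p n),
      f (algebraMap (ZMod p) (GaloisField p n) t * x) = t ^ k * f x)
    {b : GaloisField p n} {m : ℤ} {j : ZMod p} (hW : walsh p n f b = m * ez p j)
    (v : (ZMod p)ˣ) :
    ∑ x, (ZMod.stdAddChar ((v : ZMod p) ^ (k - 1) * f x +
      Algebra.trace (ZMod p) (GaloisField p n) (b * x)) : ℂ) =
      m * ZMod.stdAddChar (((v⁻¹ : (ZMod p)ˣ) : ZMod p) * j) := by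
  rw [walsh_eq_sum_stdAddChar, ez_eq_stdAddChar] at hW
  rw [← sum_stdAddChar_mul_of_sum_stdAddChar hW (v⁻¹).ne_zero]
  have hv : algebraMap (ZMod p) (GaloisField p n) v ≠ 0 := by simp
  refine Fintype.sum_equiv (Equiv.mulLeft₀ _ hv) _ _ fun x => ?_
  obtain ⟨l, rfl⟩ : ∃ l, k = l + 1 := ⟨k - 1, by lia⟩
  rw [Equiv.mulLeft₀_apply, hhom, mul_left_comm b, ← Algebra.smul_def, map_smul, smul_eq_mul,
    Nat.add_sub_cancel, pow_succ']
  congr 1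
  linear_combination (-(v : ZMod p) ^ l * f x -
    Algebra.trace (ZMod p) (GaloisField p n) (b * x)) * v.inv_mul

lemma sum_units_stdAddChar_mul (j : ZMod p) :
    ∑ v : (ZMod p)ˣ, (ZMod.stdAddChar ((v : ZMod p) * j) : ℂ) =
      (if j = 0 then (p : ℂ) else 0) - 1 := by
  have h := AddChar.sum_mulShift j (ZMod.isPrimitive_stdAddChar p)
  rw [sum_eq_zero_add_sum_units, zero_mul, AddChar.map_zero_eq_one, ZMod.card] at h
  rw [eq_sub_iff_add_eq', h]
  split_ifs <;> simp

/-- The character values of the zero set of a homogeneous weakly regular bent function. -/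
lemma mul_charHom_elt_zeroSet (hn : n ≠ 0) {k : ℕ} (hk : 0 < k)
    (hkgcd : (k - 1).gcd (p - 1) = 1)
    (hhom : ∀ (t : ZMod p) (x : GaloisField p n),
      f (algebraMap (ZMod p) (GaloisField p n) t * x) = t ^ k * f x)
    {b : GaloisField p n} {m : ℤ} {j : ZMod p} (hW : walsh p n f b = m * ez p j) :
    p * charHom (traceChar p n) b (elt p n {x | f x = 0}) =
      (if b = 0 then (p : ℂ) ^ n else 0) + m * ((if j = 0 then (p : ℂ) else 0) - 1) := by
  have hind (x : GaloisField p n) : (if f x = 0 then (p : ℂ) else 0) =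
      ∑ t : ZMod p, (ZMod.stdAddChar (t * f x) : ℂ) := by
    rw [AddChar.sum_mulShift (f x) (ZMod.isPrimitive_stdAddChar p), ZMod.card]
    split_ifs <;> simp
  have hcop : (Nat.card (ZMod p)ˣ).Coprime (k - 1) := by
    rw [Nat.card_eq_fintype_card, ZMod.card_units p]
    exact (Nat.coprime_comm).mp hkgcd
  have hsplit : p * charHom (traceChar p n) b (elt p n {x | f x = 0}) =
      ∑ t : ZMod p, ∑ x, (ZMod.stdAddChar (t * f x +
        Algebra.trace (ZMod p) (GaloisField p n) (b * x)) : ℂ) := by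
    rw [Finset.sum_comm, charHom_elt, Finset.mul_sum, Finset.sum_filter]
    refine Finset.sum_congr rfl fun x _ => ?_
    simp only [AddChar.map_add_eq_mul]
    rw [← Finset.sum_mul, ← hind, traceChar_apply, ite_mul, zero_mul]
  rw [hsplit, sum_eq_zero_add_sum_units, ← charHom_elt_univ p hn b, charHom_elt]
  congr 1
  · simp [traceChar_apply]
  · rw [← sum_units_stdAddChar_mul, Finset.mul_sum]
    refine (Fintype.sum_equiv ((Equiv.inv _).trans (powCoprime hcop)) _ _ fun v => ?_).symm
    rw [Equiv.trans_apply, powCoprime_apply, Units.val_pow_eq_pow_val, Equiv.inv_apply]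
    have h := sum_stdAddChar_unit_pow_mul_add_trace hk hhom hW v⁻¹
    rw [inv_inv] at h
    exact h.symm

/-- The dual of a homogeneous even weakly regular bent function vanishes at `0`. -/
lemma dual_zero_eq_zero (hp2 : p ≠ 2) (hf0 : f 0 = 0) (hfneg : ∀ x, f (-x) = f x)
    {m : ℤ} {j : ZMod p} (hW : walsh p n f 0 = m * ez p j) : j = 0 := by
  by_contra hj
  have hp : p.Prime := Fact.out
  have h2 : ∀ (F : Type) [Field F] [CharP F p], (2 : F) ≠ 0 := fun F _ _ h => hp2 <|
    (Nat.prime_dvd_prime_iff_eq hp Nat.prime_two).mp <|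
      (CharP.cast_eq_zero_iff F p 2).mp (by exact_mod_cast h)
  have hjneg : -j ≠ j := fun h => by
    have : 2 * j = 0 := by linear_combination -h
    exact (mul_ne_zero (h2 (ZMod p)) hj) this
  rw [walsh_eq_sum_stdAddChar, ez_eq_stdAddChar] at hW
  simp only [zero_mul, map_zero, add_zero] at hW
  have hcard := card_fiber_sub_eq_of_sum_stdAddChar hW 0 (-j)
  rw [if_neg (Ne.symm hj), if_neg hjneg, sub_zero, sub_zero, Nat.cast_inj] at hcard
  have h1 : Even #{x | f x = -j} := even_card_of_neg_mem (h2 _) (by simpa [hf0] using hj)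
    (by simp [hfneg])
  have h3 : Even #(({x | f x = 0} : Finset (GaloisField p n)).erase 0) :=
    even_card_of_neg_mem (h2 _) (by simp) (by simp [hfneg])
  have h4 := Finset.card_erase_add_one (s := ({x | f x = 0} : Finset (GaloisField p n)))
    (a := 0) (by simp [hf0])
  grind

end Bent

/-- **Case 1 of the proof of Theorem 3.5** (`p ≡ 1 (mod 4)`), identity for `D_0`: in
`ℂ[(F_{p^n},+)]`,
`p²D_0² = (−p^n + 2p|D_0| − u p^{n/2}(p−2))[F_{p^n}] + u p(p−2)p^{n/2} D_0 + (p−1)p^n·[0]`. -/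
theorem D0_group_ring_identity_one_mod_four
    (p : ℕ) [Fact p.Prime] (hp4 : p % 4 = 1) (n : ℕ) (hn : 0 < n) (hneven : Even n)
    (f fstar : GaloisField p n → ZMod p) (u : ℤ) (hu : u = 1 ∨ u = -1)
    (hW : ∀ b : GaloisField p n,
      walsh p n f b = (u : ℂ) * (p : ℂ) ^ (n / 2) * ez p (fstar b))
    (k : ℕ) (hk : 0 < k) (hkgcd : Nat.gcd (k - 1) (p - 1) = 1)
    (hhom : ∀ (t : ZMod p) (x : GaloisField p n),
      f (algebraMap (ZMod p) (GaloisField p n) t * x) = t ^ k * f x) :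
    ((p : ℂ) ^ 2) • elt p n (Finset.univ.filter fun x => f x = 0) ^ 2
      = (-(p : ℂ) ^ n + 2 * (p : ℂ) * ((Finset.univ.filter fun x => f x = 0).card : ℂ)
            - (u : ℂ) * (p : ℂ) ^ (n / 2) * ((p : ℂ) - 2)) • elt p n Finset.univ
        + ((u : ℂ) * (p : ℂ) * ((p : ℂ) - 2) * (p : ℂ) ^ (n / 2)) •
            elt p n (Finset.univ.filter fun x => f x = 0)
        + (((p : ℂ) - 1) * (p : ℂ) ^ n) • (1 : AddMonoidAlgebra ℂ (GaloisField p n)) := by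
  have hkeven : Even k := by
    by_contra hodd
    have h2 : 2 ∣ Nat.gcd (k - 1) (p - 1) := Nat.dvd_gcd (by grind) (by lia)
    lia
  have hf0 : f 0 = 0 := by simpa [hk.ne'] using hhom 0 0
  have hfneg (x : GaloisField p n) : f (-x) = f x := by
    simpa [hkeven.neg_one_pow] using hhom (-1) x
  have hW' (b : GaloisField p n) : walsh p n f b = (u * p ^ (n / 2) : ℤ) * ez p (fstar b) := by
    rw [hW]
    push_cast
    rfl
  have hstar0 : fstar 0 = 0 := dual_zero_eq_zero (by rintro rfl; lia) hf0 hfneg (hW' 0)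
  have hchar (b : GaloisField p n) := mul_charHom_elt_zeroSet hn.ne' hk hkgcd hhom (hW' b)
  have hcard := hchar 0
  have hpn : (p : ℂ) ^ n = ((p : ℂ) ^ (n / 2)) ^ 2 := by
    rw [← pow_mul, Nat.div_mul_cancel hneven.two_dvd]
  have hu2 : (u : ℂ) ^ 2 = 1 := by rcases hu with rfl | rfl <;> norm_num
  rw [charHom_elt, if_pos rfl, if_pos hstar0] at hcard
  simp only [zero_mul, AddChar.map_zero_eq_one, Finset.sum_const, nsmul_eq_mul, mul_one] at hcard
  push_cast at hcard hchar
  refine eq_of_charHom_eq (isPrimitive_traceChar p n) fun b => ?_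
  have hb := hchar b
  simp only [map_add, map_smul, map_pow, map_one, smul_eq_mul, charHom_elt_univ p hn.ne']
  set D := charHom (traceChar p n) b (elt p n {x | f x = 0})
  set N : ℂ := (#{x | f x = 0} : ℂ)
  set q : ℂ := (p : ℂ) ^ (n / 2)
  rw [hpn] at hb hcard ⊢
  have hD2 : (p : ℂ) ^ 2 * D ^ 2 = (p * D) ^ 2 := by ring
  have hD1 : (u : ℂ) * p * (p - 2) * q * D = u * (p - 2) * q * (p * D) := by ring
  have hN : 2 * (p : ℂ) * N = 2 * (p * N) := by ring
  rw [hD2, hD1, hN, hb, hcard]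
  by_cases hb0 : b = 0
  · rw [if_pos hb0, hb0, if_pos hstar0]
    linear_combination (p - 1 : ℂ) * q ^ 2 * hu2
  · rw [if_neg hb0]
    split_ifs
    · linear_combination (p - 1 : ℂ) * q ^ 2 * hu2
    · linear_combination (p - 1 : ℂ) * q ^ 2 * hu2
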